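/- arXiv:1111.2316 — 3 statements merged into one kernel-verified Lean document; each statement's English description precedes it below -/
import Mathlib

section
/- For every a ∈ A_{2n} and every integer k ≥ 1, the element [a, ω^k] − k·[a·ω^{k−1}, ω] lies in L_4(A_{2n}). -/
noncomputable section

/-- Lower central series: `lcs A 1 = A`, `lcs A (k+1) = [A, lcs A k]` (ℂ-linear span). -/
def lcs (A : Type) [Ring A] [Algebra ℂ A] : ℕ → Submodule ℂ A
  | 0 => ⊤
  | 1 => ⊤
  | (k+2) => Submodule.span ℂ {x | ∃ a : A, ∃ b ∈ lcs A (k+1), x = a * b - b * a}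

/-- The free algebra on `2n` generators. -/
abbrev FA (n : ℕ) : Type := FreeAlgebra ℂ (Fin (2*n))

/-- The generator `x_j` (1-based indexing, junk value `0` out of range). -/
def X (n : ℕ) (j : ℕ) : FA n :=
  if h : 1 ≤ j ∧ j ≤ 2*n then FreeAlgebra.ι ℂ (⟨j-1, by omega⟩ : Fin (2*n)) else 0

/-- `ω = (1/2) ∑ᵢ [xᵢ, xᵢ₊ₙ]`. -/
def omg (n : ℕ) : FA n :=
  (1/2 : ℂ) • ∑ i ∈ Finset.Icc 1 n, (X n i * X n (i+n) - X n (i+n) * X n i)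


theorem commutator_mem_lcs {A : Type} [Ring A] [Algebra ℂ A] (m : ℕ) (a : A) {b : A}
    (hb : b ∈ lcs A (m + 1)) : a * b - b * a ∈ lcs A (m + 2) :=
  Submodule.subset_span ⟨a, b, hb, rfl⟩

theorem commutator_commutator_mem_lcs {A : Type} [Ring A] [Algebra ℂ A] (m : ℕ) (a b : A) {w : A}
    (hw : w ∈ lcs A (m + 1)) :
    (a * b - b * a) * w - w * (a * b - b * a) ∈ lcs A (m + 3) := by
  have h := sub_mem (commutator_mem_lcs (m + 1) a (commutator_mem_lcs m b hw))
    (commutator_mem_lcs (m + 1) b (commutator_mem_lcs m a hw))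
  convert h using 1
  noncomm_ring

theorem commutator_pow_succ_sub_mem_lcs {A : Type} [Ring A] [Algebra ℂ A] {w : A}
    (hw : w ∈ lcs A 2) (m : ℕ) (a : A) :
    (a * w ^ (m + 1) - w ^ (m + 1) * a)
      - ((m + 1 : ℕ) : ℂ) • ((a * w ^ m) * w - w * (a * w ^ m)) ∈ lcs A 4 := by
  induction m generalizing a with
  | zero => simp
  | succ m ih =>
    have h := add_mem (ih (a * w)) (commutator_commutator_mem_lcs 1 (w ^ (m + 1)) a hw)
    convert h using 1
    have e : a * w * w ^ m = a * w ^ (m + 1) := by rw [mul_assoc, ← pow_succ']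
    have e1 : a * w * w ^ (m + 1) = a * w ^ (m + 1 + 1) := by rw [mul_assoc, ← pow_succ']
    have e2 : a * w ^ (m + 1) * w = a * w ^ (m + 1 + 1) := by rw [mul_assoc, ← pow_succ]
    have e3 : w * (w ^ (m + 1) * a) = w ^ (m + 1 + 1) * a := by rw [← mul_assoc, ← pow_succ']
    rw [Nat.cast_succ (m + 1), add_smul, one_smul, e, e1, sub_mul, mul_sub, e2, e3]
    simp only [mul_assoc]
    abel

theorem omg_mem_lcs_two (n : ℕ) : omg n ∈ lcs (FA n) 2 :=
  Submodule.smul_mem _ _ <| Submodule.sum_mem _ fun _ _ =>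
    commutator_mem_lcs 0 _ Submodule.mem_top

/-- For every `a ∈ A_{2n}` and every `k ≥ 1`,
`[a, ω^k] − k·[a·ω^{k−1}, ω] ∈ L₄(A_{2n})`. -/
theorem stmt3 (n : ℕ) (hn : 1 ≤ n) (a : FA n) (k : ℕ) (hk : 1 ≤ k) :
    (a * (omg n)^k - (omg n)^k * a)
      - (k : ℂ) • ((a * (omg n)^(k-1)) * omg n - omg n * (a * (omg n)^(k-1)))
    ∈ lcs (FA n) 4 := by
  obtain ⟨m, rfl⟩ := Nat.exists_eq_add_of_le' hk
  exact commutator_pow_succ_sub_mem_lcs (omg_mem_lcs_two n) m a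
end
end

section
/- Let k be an odd integer and s an integer with 0 ≤ 2s ≤ k−1; assume either (s = 0 and 1 ≤ k ≤ 2n−1) or (s ≥ 1 and 1 ≤ k ≤ n). Set m := k−2s (so m is odd and m+1 = k−2s+1). Define u_{(m)} := [x_m, x_{m+1}·ω^s] and, descending, u_{(j)} := [x_j, x_{j+1}·u_{(j+2)}] for j = m−2, m−4, …, 1, so that u := u_{(1)} = [x_1, x_2·[x_3, x_4·[⋯[x_m, x_{m+1}·ω^s]⋯]]]. Then the element v := [x_1, u] lies in L_3(A_{2n}) but does not lie in L_4(A_{2n}). -/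
noncomputable section

/-- `uAux n s m i = u_{(m−2i)}`, where `u_{(m)} := [x_m, x_{m+1}·ω^s]` and
`u_{(j)} := [x_j, x_{j+1}·u_{(j+2)}]` descending; so `u_{(1)} = uAux n s m ((m-1)/2)`. -/
def uAux (n s m : ℕ) : ℕ → FA n
  | 0 => X n m * (X n (m+1) * (omg n)^s) - (X n (m+1) * (omg n)^s) * X n m
  | (i+1) => X n (m-2*(i+1)) * (X n (m-2*(i+1)+1) * uAux n s m i)
      - (X n (m-2*(i+1)+1) * uAux n s m i) * X n (m-2*(i+1))

/-- The Grassmann algebra on countably many generators. -/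
abbrev Gr : Type := ExteriorAlgebra ℂ (ℕ →₀ ℂ)

namespace Gr

/-- The generators of the Grassmann algebra. -/
def e (j : ℕ) : Gr := ExteriorAlgebra.ι ℂ (Finsupp.single j 1)

/-- The parity automorphism. -/
def par : Gr →ₐ[ℂ] Gr := CliffordAlgebra.involute

/-- The odd partial derivative in the direction of the `j`-th generator. -/
def pd (j : ℕ) : Gr →ₗ[ℂ] Gr := CliffordAlgebra.contractLeft (Finsupp.lapply j)

/-- The algebra homomorphism `x ↦ x + ε · deg x`. -/
def degHom : Gr →ₐ[ℂ] DualNumber Gr :=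
  ExteriorAlgebra.lift ℂ ⟨(TrivSqZeroExt.inlAlgHom ℂ Gr Gr).toLinearMap ∘ₗ ExteriorAlgebra.ι ℂ +
      (TrivSqZeroExt.inrHom Gr Gr).restrictScalars ℂ ∘ₗ ExteriorAlgebra.ι ℂ, by
    intro v
    ext <;> simp⟩

/-- The Euler derivation. -/
def deg (x : Gr) : Gr := (degHom x).snd

@[elab_as_elim]
theorem induction {C : Gr → Prop} (hr : ∀ r : ℂ, C (algebraMap ℂ Gr r))
    (hv : ∀ v, C (ExteriorAlgebra.ι ℂ v)) (hm : ∀ a b, C a → C b → C (a * b))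
    (ha : ∀ a b, C a → C b → C (a + b)) (x : Gr) : C x :=
  ExteriorAlgebra.induction hr hv hm ha x

@[simp] theorem par_ι (v : ℕ →₀ ℂ) : par (ExteriorAlgebra.ι ℂ v) = -ExteriorAlgebra.ι ℂ v :=
  CliffordAlgebra.involute_ι v

@[simp] theorem par_e (j : ℕ) : par (e j) = -e j := par_ι _

@[simp] theorem par_par (x : Gr) : par (par x) = x := CliffordAlgebra.involute_involute x

@[simp] theorem pd_ι (j : ℕ) (v : ℕ →₀ ℂ) :
    pd j (ExteriorAlgebra.ι ℂ v) = algebraMap ℂ Gr (v j) :=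
  CliffordAlgebra.contractLeft_ι _ _ _

@[simp] theorem pd_algebraMap (j : ℕ) (r : ℂ) : pd j (algebraMap ℂ Gr r) = 0 :=
  CliffordAlgebra.contractLeft_algebraMap _ _ _

@[simp] theorem pd_one (j : ℕ) : pd j 1 = 0 := by
  simpa using pd_algebraMap j 1

@[simp] theorem pd_e_self (j : ℕ) : pd j (e j) = 1 := by simp [e]

theorem pd_e_of_ne {i j : ℕ} (h : i ≠ j) : pd i (e j) = 0 := by
  simp [e, h.symm]

theorem pd_ι_mul (j : ℕ) (v : ℕ →₀ ℂ) (b : Gr) :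
    pd j (ExteriorAlgebra.ι ℂ v * b) = v j • b - ExteriorAlgebra.ι ℂ v * pd j b :=
  CliffordAlgebra.contractLeft_ι_mul _ _ _

theorem pd_mul (j : ℕ) (x y : Gr) : pd j (x * y) = pd j x * y + par x * pd j y := by
  induction x using Gr.induction generalizing y with
  | hr r => simp [← Algebra.smul_def]
  | hv v => simp [pd_ι_mul, Algebra.smul_def, sub_eq_add_neg]
  | hm a b ha hb => rw [mul_assoc, ha, hb, ha b, map_mul]; noncomm_ring
  | ha a b ha hb => simp only [add_mul, map_add, ha, hb]; abel

theorem fst_degHom (x : Gr) : (degHom x).fst = x := by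
  induction x using Gr.induction with
  | hr r => simp [AlgHom.commutes, TrivSqZeroExt.algebraMap_eq_inl']
  | hv v => simp [degHom]
  | hm a b ha hb => simp [ha, hb]
  | ha a b ha hb => simp [ha, hb]

theorem deg_mul (x y : Gr) : deg (x * y) = x * deg y + deg x * y := by
  simp [deg, fst_degHom]

theorem deg_add (x y : Gr) : deg (x + y) = deg x + deg y := by
  simp [deg]

theorem deg_smul (c : ℂ) (x : Gr) : deg (c • x) = c • deg x := by
  simp [deg]

@[simp] theorem deg_algebraMap (r : ℂ) : deg (algebraMap ℂ Gr r) = 0 := by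
  simp [deg, AlgHom.commutes, TrivSqZeroExt.algebraMap_eq_inl']

@[simp] theorem deg_zero : deg 0 = 0 := by simp [deg]

@[simp] theorem deg_one : deg 1 = 0 := by simp [deg]

@[simp] theorem deg_ι (v : ℕ →₀ ℂ) : deg (ExteriorAlgebra.ι ℂ v) = ExteriorAlgebra.ι ℂ v := by
  simp [deg, degHom]

@[simp] theorem deg_e (j : ℕ) : deg (e j) = e j := deg_ι _

theorem ι_mul (v : ℕ →₀ ℂ) (y : Gr) :
    ExteriorAlgebra.ι ℂ v * y = par y * ExteriorAlgebra.ι ℂ v := by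
  induction y using Gr.induction with
  | hr r => simp [Algebra.commutes]
  | hv w =>
    rw [par_ι, neg_mul, eq_neg_iff_add_eq_zero]
    exact ExteriorAlgebra.ι_add_mul_swap v w
  | hm a b ha hb => rw [← mul_assoc, ha, mul_assoc, hb, map_mul, mul_assoc]
  | ha a b ha hb => simp only [mul_add, add_mul, map_add, ha, hb]

theorem e_mul (j : ℕ) (y : Gr) : e j * y = par y * e j := ι_mul _ _

@[simp] theorem e_mul_self (j : ℕ) : e j * e j = 0 := ExteriorAlgebra.ι_sq_zero _

theorem commute_of_par_eq {y : Gr} (hy : par y = y) (x : Gr) : x * y = y * x := by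
  induction x using Gr.induction with
  | hr r => simp [Algebra.commutes]
  | hv v => rw [ι_mul, hy]
  | hm a b ha hb => rw [mul_assoc, hb, ← mul_assoc, ha, mul_assoc]
  | ha a b ha hb => rw [add_mul, mul_add, ha, hb]

theorem par_commutator (x y : Gr) : par (x * y - y * x) = x * y - y * x := by
  have h1 := commute_of_par_eq (y := y + par y) (by simp [add_comm]) (par x)
  have h2 := commute_of_par_eq (y := x + par x) (by simp [add_comm]) y
  simp only [map_sub, map_mul]
  simp only [mul_add, add_mul] at h1 h2
  rw [← sub_eq_zero] at h1 h2 ⊢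
  rw [← add_zero (0 : Gr)]
  nth_rw 1 [← h1]
  rw [← h2]
  abel

theorem par_twisted_commutator (x d : Gr) :
    par x * d - d * x + x * par d - par d * par x = 0 := by
  induction x using Gr.induction generalizing d with
  | hr r => simp [Algebra.commutes]
  | hv v =>
    have h1 := ι_mul v d
    have h2 := ι_mul v (par d)
    rw [par_par] at h2
    rw [h2, par_ι, neg_mul, h1]
    noncomm_ring
  | hm a b ha hb =>
    have h1 := ha (par b * d)
    have h2 := hb (d * a)
    simp only [map_mul, par_par] at h1 h2 ⊢
    rw [← add_zero (0 : Gr)]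
    nth_rw 1 [← h1]
    rw [← h2]
    noncomm_ring
  | ha a b ha hb =>
    have h := congrArg₂ (· + ·) (ha d) (hb d)
    simp only [add_zero] at h
    rw [← h]
    simp only [map_add]
    noncomm_ring

theorem ne_zero_of_pd_eq_zero {j : ℕ} {x : Gr} (hx : x ≠ 0) (h : pd j x = 0) : e j * x ≠ 0 := by
  intro h0
  apply hx
  simpa [pd_mul, h] using congrArg (pd j) h0

/-- The partial symplectic form supported on the pairs indexed by `T`. -/
def symp (n : ℕ) (T : Finset ℕ) : Gr := ∑ i ∈ T, e i * e (i + n)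

theorem par_symp (n : ℕ) (T : Finset ℕ) : par (symp n T) = symp n T := by
  simp [symp]

theorem deg_symp_pow (n : ℕ) (T : Finset ℕ) (s : ℕ) :
    deg (symp n T ^ s) = ((2 * s : ℕ) : ℂ) • symp n T ^ s := by
  have h1 : deg (symp n T) = (2 : ℂ) • symp n T := by
    unfold symp
    induction T using Finset.induction_on with
    | empty => simp
    | insert a T ha ih =>
      rw [Finset.sum_insert ha, deg_add, ih, deg_mul]
      simp only [deg_e, smul_add, two_smul]
  induction s with
  | zero => simp
  | succ s ih =>
    rw [pow_succ, deg_mul, ih, h1, mul_smul_comm, smul_mul_assoc, ← add_smul]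
    congr 1
    push_cast
    ring

theorem pd_pow {j : ℕ} {x : Gr} (h : pd j x = 0) (s : ℕ) : pd j (x ^ s) = 0 := by
  induction s with
  | zero => simp
  | succ s ih => simp [pow_succ, pd_mul, h, ih]

theorem pd_symp {n l : ℕ} {T : Finset ℕ} (h : ∀ i ∈ T, l ≠ i ∧ l ≠ i + n) :
    pd l (symp n T) = 0 := by
  rw [symp, map_sum]
  exact Finset.sum_eq_zero fun i hi => by
    simp [pd_mul, pd_e_of_ne (h i hi).1, pd_e_of_ne (h i hi).2]

theorem symp_pow_ne_zero {n : ℕ} (s : ℕ) (T : Finset ℕ) (hT : T ⊆ Finset.Icc 1 n)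
    (hs : s ≤ T.card) : symp n T ^ s ≠ 0 := by
  induction s generalizing T with
  | zero => simp
  | succ s ih =>
    obtain ⟨i, hi⟩ : T.Nonempty := Finset.card_pos.mp (by omega)
    have hS := ih (T.erase i) ((Finset.erase_subset _ _).trans hT)
      (by rw [Finset.card_erase_of_mem hi]; omega)
    have hin := Finset.mem_Icc.mp (hT hi)
    have hd1 : pd i (symp n (T.erase i)) = 0 := pd_symp fun l hl => by
      have := Finset.mem_Icc.mp (hT (Finset.mem_of_mem_erase hl))
      have := Finset.ne_of_mem_erase hl
      omega
    have hd2 : pd (i + n) (symp n (T.erase i)) = 0 := pd_symp fun l hl => by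
      have := Finset.mem_Icc.mp (hT (Finset.mem_of_mem_erase hl))
      have := Finset.ne_of_mem_erase hl
      omega
    have hp : par (e i * e (i + n)) = e i * e (i + n) := by simp
    have hsum : symp n T = symp n (T.erase i) + e i * e (i + n) :=
      (Finset.sum_erase_add _ _ hi).symm
    have hpp : e i * e (i + n) * (e i * e (i + n)) = 0 := by
      rw [← mul_assoc, mul_assoc (e i), e_mul (i + n) (e i)]
      simp [← mul_assoc]
    have hexp : ∀ t : ℕ, symp n T ^ (t + 1) = symp n (T.erase i) ^ (t + 1) +
        ((t + 1 : ℕ) : ℂ) • (e i * (e (i + n) * symp n (T.erase i) ^ t)) := by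
      intro t
      have hc := commute_of_par_eq hp (symp n (T.erase i) ^ t)
      induction t with
      | zero => simp [hsum]
      | succ t iht =>
        have hc1 := commute_of_par_eq hp (symp n (T.erase i) ^ t)
        have hz : e i * (e (i + n) * symp n (T.erase i) ^ t) * (e i * e (i + n)) = 0 := by
          rw [commute_of_par_eq hp, ← mul_assoc (e i) (e (i + n)), ← mul_assoc, hpp, zero_mul]
        rw [pow_succ, iht hc1, hsum, mul_add, add_mul, add_mul, smul_mul_assoc, smul_mul_assoc,
          hz, hc, ← pow_succ]
        simp only [pow_succ, ← mul_assoc]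
        push_cast
        module
    rw [hexp]
    intro h0
    have h1 := congrArg (pd i) h0
    rw [map_add, pd_pow hd1, map_smul, map_zero, zero_add, pd_mul,
      pd_mul, pd_pow hd1, pd_e_self, pd_e_of_ne (by omega : i ≠ i + n)] at h1
    simp only [one_mul, zero_mul, mul_zero, add_zero] at h1
    rw [smul_eq_zero] at h1
    rcases h1 with h1 | h1
    · exact absurd h1 (by exact_mod_cast Nat.succ_ne_zero s)
    · exact ne_zero_of_pd_eq_zero hS (pd_pow hd2 s) h1

end Gr

section Detection

open Gr

variable {σ : Type} (w : σ → ℕ →₀ ℂ)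

/-- The map of the free algebra to the Grassmann algebra given by vectors `w`. -/
def grHom : FreeAlgebra ℂ σ →ₐ[ℂ] Gr :=
  FreeAlgebra.lift ℂ fun i => ExteriorAlgebra.ι ℂ (w i)

/-- A triangular representation whose corner entry detects `L₃ / L₄`. -/
def triRep : FreeAlgebra ℂ σ →ₐ[ℂ] Matrix (Fin 3) (Fin 3) Gr :=
  FreeAlgebra.lift ℂ fun i =>
    !![-ExteriorAlgebra.ι ℂ (w i), algebraMap ℂ Gr (w i 1), 0;
       0, ExteriorAlgebra.ι ℂ (w i), ExteriorAlgebra.ι ℂ (w i);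
       0, 0, ExteriorAlgebra.ι ℂ (w i)]

/-- The corner entry of `triRep`. -/
def corner (a : FreeAlgebra ℂ σ) : Gr := triRep w a 0 2

@[simp] theorem grHom_ι (i : σ) :
    grHom w (FreeAlgebra.ι ℂ i) = ExteriorAlgebra.ι ℂ (w i) := by
  simp [grHom]

theorem triRep_eq (a : FreeAlgebra ℂ σ) :
    triRep w a = !![par (grHom w a), pd 1 (grHom w a), corner w a;
      0, grHom w a, deg (grHom w a); 0, 0, grHom w a] := by
  induction a using FreeAlgebra.induction with
  | grade0 r =>
    ext i j
    fin_cases i <;> fin_cases j <;> simp [corner, Matrix.algebraMap_matrix_apply, AlgHom.commutes]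
  | grade1 i =>
    ext k l
    fin_cases k <;> fin_cases l <;> simp [corner, triRep]
  | mul a b ha hb =>
    have h : corner w (a * b) = (triRep w a * triRep w b) 0 2 := by simp [corner]
    rw [h, map_mul, ha, hb]
    ext i j
    fin_cases i <;> fin_cases j <;>
      simp [Matrix.mul_apply, Fin.sum_univ_three, pd_mul, deg_mul, add_comm]
  | add a b ha hb =>
    have h : corner w (a + b) = (triRep w a + triRep w b) 0 2 := by simp [corner]
    rw [h, map_add, ha, hb]
    ext i j
    fin_cases i <;> fin_cases j <;> simp [deg_add]

theorem corner_mul (a b : FreeAlgebra ℂ σ) :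
    corner w (a * b) = par (grHom w a) * corner w b + pd 1 (grHom w a) * deg (grHom w b) +
      corner w a * grHom w b := by
  have h : corner w (a * b) = (triRep w a * triRep w b) 0 2 := by simp [corner]
  rw [h, triRep_eq, triRep_eq]
  simp [Matrix.mul_apply, Fin.sum_univ_three]

theorem corner_sub (a b : FreeAlgebra ℂ σ) :
    corner w (a - b) = corner w a - corner w b := by
  simp [corner]

theorem par_grHom_of_mem_lcs_two {a : FreeAlgebra ℂ σ} (ha : a ∈ lcs (FreeAlgebra ℂ σ) 2) :
    par (grHom w a) = grHom w a := by
  rw [lcs] at ha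
  induction ha using Submodule.span_induction with
  | mem x hx =>
    obtain ⟨a, b, -, rfl⟩ := hx
    rw [map_sub, map_mul, map_mul, par_commutator]
  | zero => simp
  | add x y _ _ hx hy => simp [hx, hy]
  | smul c x _ hx => simp [hx]

theorem grHom_of_mem_lcs_three {a : FreeAlgebra ℂ σ} (ha : a ∈ lcs (FreeAlgebra ℂ σ) 3) :
    grHom w a = 0 := by
  rw [lcs] at ha
  induction ha using Submodule.span_induction with
  | mem x hx =>
    obtain ⟨a, b, hb, rfl⟩ := hx
    rw [map_sub, map_mul, map_mul, commute_of_par_eq (par_grHom_of_mem_lcs_two w hb), sub_self]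
  | zero => simp
  | add x y _ _ hx hy => simp [hx, hy]
  | smul c x _ hx => simp [hx]

theorem corner_of_mem_lcs_four {a : FreeAlgebra ℂ σ} (ha : a ∈ lcs (FreeAlgebra ℂ σ) 4) :
    corner w a + par (corner w a) = 0 := by
  rw [lcs] at ha
  induction ha using Submodule.span_induction with
  | mem x hx =>
    obtain ⟨a, b, hb, rfl⟩ := hx
    have h := par_twisted_commutator (grHom w a) (corner w b)
    rw [corner_sub, corner_mul, corner_mul, grHom_of_mem_lcs_three w hb]
    simp only [deg_zero, map_zero, mul_zero, zero_mul, add_zero, zero_add, map_sub, map_mul,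
      par_par]
    rw [← h]
    abel
  | zero => simp [corner]
  | add x y _ _ hx hy =>
    have h := congrArg₂ (· + ·) hx hy
    simp only [add_zero] at h
    rw [← h]
    simp only [corner, map_add, Matrix.add_apply]
    abel
  | smul c x _ hx =>
    have h := congrArg (c • ·) hx
    simpa [corner] using h

/-- A generator `y ↦ e 1` bracketed with an element whose image is an even eigenvector
`e 1 * W` of the Euler derivation does not fall into `L₄`. -/
theorem commutator_notMem_lcs_four {y u : FreeAlgebra ℂ σ} {W : Gr} {c : ℕ}
    (hy : grHom w y = e 1) (hyc : corner w y = 0) (hW : par W = -W) (hu : grHom w u = e 1 * W)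
    (hdeg : deg (grHom w u) = (c : ℂ) • grHom w u) (h0 : grHom w u ≠ 0) :
    y * u - u * y ∉ lcs (FreeAlgebra ℂ σ) 4 := by
  intro hmem
  have hpar : par (grHom w u) = grHom w u := by simp [hu, hW]
  have hpd : pd 1 (grHom w u) * e 1 = -grHom w u := by
    have h1 : e 1 * W = -(W * e 1) := by rw [e_mul, hW, neg_mul]
    have h2 : e 1 * pd 1 W * e 1 = 0 := by rw [e_mul, mul_assoc, e_mul_self, mul_zero]
    rw [hu, pd_mul, pd_e_self, one_mul, add_mul, par_e, neg_mul, neg_mul, h2, h1]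
    simp
  have h := corner_of_mem_lcs_four w hmem
  rw [corner_sub, corner_mul, corner_mul, hyc, hy, hpar, deg_e, hpd, hdeg] at h
  have h1 := par_twisted_commutator (e 1) (corner w u)
  simp only [par_e, pd_e_self, map_add, map_sub, map_mul, map_neg, map_smul, hpar,
    mul_zero, zero_mul, add_zero, zero_add, one_mul] at h h1
  have h2 : (2 * (c + 1) : ℂ) • grHom w u = 0 := by
    rw [← sub_zero (0 : Gr)]
    nth_rw 1 [← h]
    rw [← h1]
    simp only [neg_mul, mul_neg]
    module
  rcases smul_eq_zero.mp h2 with h3 | h3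
  · exact absurd h3 (mul_ne_zero two_ne_zero (Nat.cast_add_one_ne_zero c))
  · exact h0 h3

end Detection

namespace Gr

/-- A nonzero even eigenvector of the Euler derivation that does not involve `e 1, …, e (j - 1)`. -/
structure EvenAbove (j c : ℕ) (R : Gr) : Prop where
  par_eq : par R = R
  deg_eq : deg R = (c : ℂ) • R
  pd_eq : ∀ l, 1 ≤ l → l < j → pd l R = 0
  ne_zero : R ≠ 0

theorem commutator_e_mul {j : ℕ} {R : Gr} (hR : par R = R) :
    e j * (e (j + 1) * R) - e (j + 1) * R * e j = e j * ((2 : ℂ) • (e (j + 1) * R)) := by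
  have h : e (j + 1) * R * e j = -(e j * (e (j + 1) * R)) := by
    rw [e_mul j, map_mul, hR, par_e, neg_mul, neg_mul, neg_neg]
  rw [h, mul_smul_comm, two_smul, sub_neg_eq_add]

theorem EvenAbove.commutator {j c : ℕ} {R : Gr} (hj : 1 ≤ j) (h : EvenAbove (j + 2) c R) :
    EvenAbove j (c + 2) (e j * (e (j + 1) * R) - e (j + 1) * R * e j) := by
  rw [commutator_e_mul h.par_eq, mul_smul_comm]
  refine ⟨by simp [h.par_eq], ?_, fun l hl hlj => ?_, smul_ne_zero two_ne_zero ?_⟩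
  · rw [deg_smul, deg_mul, deg_mul, deg_e, deg_e, h.deg_eq]
    simp only [mul_smul_comm, mul_add]
    push_cast
    module
  · rw [map_smul, pd_mul, pd_mul, pd_e_of_ne (by omega), pd_e_of_ne (by omega),
      h.pd_eq l hl (by omega)]
    simp
  · refine ne_zero_of_pd_eq_zero
      (ne_zero_of_pd_eq_zero h.ne_zero (h.pd_eq _ (by omega) (by omega))) ?_
    rw [pd_mul, pd_e_of_ne (by omega), h.pd_eq j hj (by omega)]
    simp

end Gr

section Words

open Gr

variable (n s m : ℕ)

/-- The generator `x_j` is sent to `e j`, except that for `s ≠ 0` the partners of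
`x_1, …, x_{m+1}` are sent to zero. -/
def wt (i : Fin (2 * n)) : ℕ →₀ ℂ :=
  if s ≠ 0 ∧ n ≤ i.val ∧ i.val ≤ n + m then 0 else Finsupp.single (i.val + 1) 1

variable {n s m}

theorem X_eq {j : ℕ} (h1 : 1 ≤ j) (h2 : j ≤ 2 * n) :
    X n j = FreeAlgebra.ι ℂ (⟨j - 1, by omega⟩ : Fin (2 * n)) :=
  dif_pos ⟨h1, h2⟩

theorem grHom_X {j : ℕ} (h1 : 1 ≤ j) (h2 : j ≤ 2 * n)
    (h : ¬(s ≠ 0 ∧ n + 1 ≤ j ∧ j ≤ n + m + 1)) : grHom (wt n s m) (X n j) = e j := by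
  rw [X_eq h1 h2, grHom_ι, wt, if_neg (by simp only; omega), e, Nat.sub_add_cancel h1]

theorem grHom_X_eq_zero {j : ℕ} (h2 : j ≤ 2 * n) (h : s ≠ 0 ∧ n + 1 ≤ j ∧ j ≤ n + m + 1) :
    grHom (wt n s m) (X n j) = 0 := by
  rw [X_eq (by omega) h2, grHom_ι, wt, if_pos (by simp only; omega), map_zero]

theorem grHom_omg (hs : s ≠ 0) :
    grHom (wt n s m) (omg n) = symp n (Finset.Icc (m + 2) n) := by
  have hsub : Finset.Icc (m + 2) n ⊆ Finset.Icc 1 n := Finset.Icc_subset_Icc_left (by omega)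
  rw [omg, map_smul, map_sum, symp, ← Finset.sum_subset hsub, Finset.smul_sum]
  · refine Finset.sum_congr rfl fun i hi => ?_
    rw [Finset.mem_Icc] at hi
    rw [map_sub, map_mul, map_mul, grHom_X (by omega) (by omega) (by omega),
      grHom_X (by omega) (by omega) (by omega), e_mul (i + n), par_e, neg_mul, sub_neg_eq_add,
      ← two_smul ℂ, smul_smul]
    norm_num
  · intro i hi hi'
    rw [Finset.mem_Icc] at hi hi'
    rw [map_sub, map_mul, map_mul, grHom_X_eq_zero (j := i + n) (by omega) (by omega)]
    simp

theorem evenAbove_omg_pow (h : s = 0 ∨ m + 2 * s ≤ n) :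
    EvenAbove (m + 2) (2 * s) (grHom (wt n s m) (omg n ^ s)) := by
  rcases Nat.eq_zero_or_pos s with rfl | hs
  · exact ⟨by simp, by simp, by simp, by simp⟩
  · rw [map_pow, grHom_omg (by omega)]
    refine ⟨by rw [map_pow, par_symp], deg_symp_pow _ _ _, fun l _ hl => pd_pow (pd_symp ?_) s,
      symp_pow_ne_zero s _ (Finset.Icc_subset_Icc_left (by omega)) ?_⟩
    · intro i hi
      rw [Finset.mem_Icc] at hi
      omega
    · rw [Nat.card_Icc]
      omega

theorem exists_evenAbove_uAux (h : s = 0 ∧ m + 1 ≤ 2 * n ∨ 1 ≤ s ∧ m + 2 * s ≤ n) (i : ℕ)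
    (hi : 2 * i + 1 ≤ m) : ∃ (R : FA n) (c : ℕ),
      EvenAbove (m - 2 * i + 2) c (grHom (wt n s m) R) ∧
      uAux n s m i = X n (m - 2 * i) * (X n (m - 2 * i + 1) * R) -
        X n (m - 2 * i + 1) * R * X n (m - 2 * i) := by
  induction i with
  | zero => exact ⟨omg n ^ s, _, evenAbove_omg_pow (by omega), rfl⟩
  | succ i ih =>
    obtain ⟨R, c, hR, hu⟩ := ih (by omega)
    refine ⟨uAux n s m i, c + 2, ?_, rfl⟩
    rw [hu, map_sub, map_mul, map_mul, map_mul, map_mul,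
      grHom_X (by omega) (by omega) (by omega), grHom_X (by omega) (by omega) (by omega),
      show m - 2 * (i + 1) + 2 = m - 2 * i by omega]
    exact hR.commutator (by omega)

end Words

/-- For `k` odd, `0 ≤ 2s ≤ k−1`, and either (`s = 0` and `1 ≤ k ≤ 2n−1`) or
(`s ≥ 1` and `1 ≤ k ≤ n`), with `m := k−2s` and
`u := [x_1, x_2·[x_3, x_4·[⋯[x_m, x_{m+1}·ω^s]⋯]]]`, the element `v := [x_1, u]`
lies in `L₃(A_{2n})` but not in `L₄(A_{2n})`. -/
theorem stmt5 (n : ℕ) (hn : 1 ≤ n) (k s : ℕ) (hodd : Odd k) (hs : 2*s ≤ k-1)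
    (hrange : (s = 0 ∧ 1 ≤ k ∧ k ≤ 2*n - 1) ∨ (1 ≤ s ∧ 1 ≤ k ∧ k ≤ n))
    (m : ℕ) (hm : m = k - 2*s)
    (u : FA n) (hu : u = uAux n s m ((m-1)/2))
    (v : FA n) (hv : v = X n 1 * u - u * X n 1) :
    v ∈ lcs (FA n) 3 ∧ v ∉ lcs (FA n) 4 := by
  have hk : s = 0 ∧ m + 1 ≤ 2 * n ∨ 1 ≤ s ∧ m + 2 * s ≤ n := by omega
  obtain ⟨q, rfl⟩ := hodd
  obtain ⟨R, c, hR, hR'⟩ := exists_evenAbove_uAux hk ((m - 1) / 2) (by omega)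
  have hm1 : m - 2 * ((m - 1) / 2) = 1 := by omega
  rw [hm1] at hR hR'
  rw [← hu] at hR'
  have hX1 : Gr.e 1 = grHom (wt n s m) (X n 1) :=
    (grHom_X le_rfl (by omega) (by omega)).symm
  have hX2 : Gr.e (1 + 1) = grHom (wt n s m) (X n (1 + 1)) :=
    (grHom_X (by omega) (by omega) (by omega)).symm
  have hu' : grHom (wt n s m) u = Gr.e 1 * (Gr.e (1 + 1) * grHom (wt n s m) R) -
      Gr.e (1 + 1) * grHom (wt n s m) R * Gr.e 1 := by
    rw [hR', hX1, hX2]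
    simp only [map_sub, map_mul]
  have hE := hR.commutator le_rfl
  rw [← hu'] at hE
  have hu2 : u ∈ lcs (FA n) 2 := by
    rw [lcs]
    exact Submodule.subset_span ⟨X n 1, X n (1 + 1) * R, by simp [lcs], hR'⟩
  rw [hv]
  refine ⟨?_, ?_⟩
  · rw [lcs]
    exact Submodule.subset_span ⟨X n 1, u, hu2, rfl⟩
  · refine commutator_notMem_lcs_four (wt n s m) hX1.symm ?_ ?_
      (hu'.trans (Gr.commutator_e_mul hR.par_eq)) hE.deg_eq hE.ne_zero
    · rw [X_eq le_rfl (by omega)]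
      simp [corner, triRep]
    · simp [hR.par_eq]
end
end

section
/- Let k be an odd integer and s an integer with 0 ≤ 2s ≤ k−1 and 1 ≤ k ≤ n. Set m := k−2s. Define u_{(m)} := [x_m, x_{m+1}·ω^s] and, descending, u_{(j)} := [x_j, x_{j+1}·u_{(j+2)}] for j = m−2, m−4, …, 1, and set v := [x_1, u_{(1)}]. Then for every l with 1 ≤ l ≤ 2n, the element ∂_l(v) lies in L_4(A_{2n}) (that is, v is annihilated by all constant vector fields in B_3(A_{2n}) = L_3/L_4). -/
noncomputable section

section LowerCentralSeries

attribute [local instance] LieRing.ofAssociativeRing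

variable {A : Type} [Ring A]

/-- An identity exhibiting `3 • ⁅a, b * ⁅c, ⁅d, e⁆⁆⁆` as a combination of fourfold commutators. -/
theorem three_nsmul_lie_mul_lie_lie (a b c d e : A) :
    (3 : ℕ) • ⁅a, b * ⁅c, ⁅d, e⁆⁆⁆ =
      ⁅(a * b), ⁅c, ⁅d, e⁆⁆⁆
      + ⁅a, ⁅(b * c), ⁅d, e⁆⁆⁆
      - ⁅a, ⁅e, ⁅b, (c * d)⁆⁆⁆
      + ⁅(e * b), ⁅c, ⁅a, d⁆⁆⁆
      + ⁅(a * d), ⁅c, ⁅b, e⁆⁆⁆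
      + ⁅(a * e), ⁅b, ⁅c, d⁆⁆⁆
      - ⁅b, ⁅(a * d), ⁅c, e⁆⁆⁆
      - ⁅b, ⁅(c * a), ⁅d, e⁆⁆⁆
      + ⁅b, ⁅c, ⁅a, (d * e)⁆⁆⁆
      - ⁅b, ⁅c, ⁅(a * e), d⁆⁆⁆
      + ⁅(d * c), ⁅e, ⁅a, b⁆⁆⁆
      - ⁅b, ⁅(c * e), ⁅a, d⁆⁆⁆
      - ⁅(b * d), ⁅e, ⁅a, c⁆⁆⁆
      - ⁅(b * e), ⁅a, ⁅c, d⁆⁆⁆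
      - ⁅(c * a), ⁅b, ⁅d, e⁆⁆⁆
      + ⁅c, ⁅d, ⁅a, (b * e)⁆⁆⁆
      - ⁅c, ⁅(a * e), ⁅b, d⁆⁆⁆
      - ⁅c, ⁅e, ⁅a, (b * d)⁆⁆⁆
      - ⁅d, ⁅(c * e), ⁅a, b⁆⁆⁆
      - ⁅(d * a), ⁅b, ⁅c, e⁆⁆⁆
      + ⁅(e * c), ⁅a, ⁅b, d⁆⁆⁆
      + ⁅d, ⁅b, ⁅(a * c), e⁆⁆⁆ := by
  simp only [Ring.lie_def, mul_sub, sub_mul, mul_assoc]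
  abel

variable [Algebra ℂ A]

theorem lie_mem_lcs (k : ℕ) (a : A) {b : A} (hb : b ∈ lcs A (k + 1)) :
    ⁅a, b⁆ ∈ lcs A (k + 2) := by
  rw [lcs]
  exact Submodule.subset_span ⟨a, b, hb, rfl⟩

theorem lcs_succ_le : ∀ k : ℕ, lcs A (k + 1) ≤ lcs A k
  | 0 => le_top
  | 1 => le_top
  | k + 2 => by
    rw [lcs, Submodule.span_le]
    rintro _ ⟨a, b, hb, rfl⟩
    exact lie_mem_lcs k a (lcs_succ_le (k + 1) hb)

theorem lie_mem_lcs_two (a b : A) : ⁅a, b⁆ ∈ lcs A 2 :=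
  lie_mem_lcs 0 a (by simp [lcs])

theorem lie_lie_lie_mem_lcs_four (a b c d : A) : ⁅a, ⁅b, ⁅c, d⁆⁆⁆ ∈ lcs A 4 :=
  lie_mem_lcs 2 a (lie_mem_lcs 1 b (lie_mem_lcs_two c d))

theorem lie_mul_lie_lie_mem_lcs_four (a b c d e : A) :
    ⁅a, b * ⁅c, ⁅d, e⁆⁆⁆ ∈ lcs A 4 := by
  have h : (3 : ℂ) • ⁅a, b * ⁅c, ⁅d, e⁆⁆⁆ ∈ lcs A 4 := by
    rw [show (3 : ℂ) = ((3 : ℕ) : ℂ) by norm_num, Nat.cast_smul_eq_nsmul,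
      three_nsmul_lie_mul_lie_lie]
    repeat'
      first
      | exact lie_lie_lie_mem_lcs_four _ _ _ _
      | apply Submodule.add_mem
      | apply Submodule.sub_mem
  exact (Submodule.smul_mem_iff _ three_ne_zero).1 h

/-- The inclusion `⁅A, A * L₃(A)⁆ ⊆ L₄(A)`. -/
theorem lie_mul_mem_lcs_four (a b : A) {w : A} (hw : w ∈ lcs A 3) : ⁅a, b * w⁆ ∈ lcs A 4 := by
  rw [lcs] at hw
  induction hw using Submodule.span_induction with
  | mem w hw =>
    obtain ⟨c, y, hy, rfl⟩ := hw
    rw [← Ring.lie_def]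
    rw [lcs] at hy
    induction hy using Submodule.span_induction with
    | mem y hy =>
      obtain ⟨d, e, -, rfl⟩ := hy
      exact lie_mul_lie_lie_mem_lcs_four a b c d e
    | zero => simp
    | add x y _ _ hx hy => simpa only [lie_add, mul_add] using add_mem hx hy
    | smul t x _ hx =>
      simpa only [lie_smul, mul_smul_comm] using Submodule.smul_mem _ t hx
  | zero => simp
  | add x y _ _ hx hy => simpa only [lie_add, mul_add] using add_mem hx hy
  | smul t x _ hx =>
    simpa only [lie_smul, mul_smul_comm] using Submodule.smul_mem _ t hx

theorem lie_lie_mul_mem_lcs_three (a x y : A) {z : A} (hz : ⁅x, z⁆ ∈ lcs A 3) :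
    ⁅a, ⁅x, y⁆ * z⁆ ∈ lcs A 3 := by
  have h : ⁅a, ⁅x, y⁆ * z⁆ = ⁅a, ⁅x, y * z⁆⁆ - ⁅a, y * ⁅x, z⁆⁆ := by
    simp only [Ring.lie_def, mul_sub, sub_mul, mul_assoc]
    abel
  rw [h]
  exact sub_mem (lie_mem_lcs 1 a (lie_mem_lcs_two _ _))
    (lcs_succ_le 3 (lie_mul_mem_lcs_four a y hz))

theorem lie_omg_pow_mem_lcs_three (n s : ℕ) : ∀ a : FA n, ⁅a, omg n ^ s⁆ ∈ lcs (FA n) 3 := by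
  induction s with
  | zero => intro a; simp [Ring.lie_def]
  | succ s ih =>
    intro a
    have h : ⁅a, omg n ^ (s + 1)⁆ = (1 / 2 : ℂ) • ∑ i ∈ Finset.Icc 1 n,
        ⁅a, ⁅X n i, X n (i + n)⁆ * omg n ^ s⁆ := by
      rw [pow_succ']
      nth_rw 1 [omg]
      rw [smul_mul_assoc, lie_smul, Finset.sum_mul, lie_sum]
      rfl
    rw [h]
    exact Submodule.smul_mem _ _ (Submodule.sum_mem _ fun i _ =>
      lie_lie_mul_mem_lcs_three a _ _ (ih _))

theorem uAux_mem_lcs_two (n s m i : ℕ) : uAux n s m i ∈ lcs (FA n) 2 := by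
  cases i with
  | zero => exact lie_mem_lcs_two _ _
  | succ i => exact lie_mem_lcs_two _ _

section Derivation

variable {n : ℕ} {D : FA n →ₗ[ℂ] FA n}

theorem map_lie_of_leibniz (hD : ∀ a b : FA n, D (a * b) = D a * b + a * D b) (a b : FA n) :
    D ⁅a, b⁆ = ⁅D a, b⁆ + ⁅a, D b⁆ := by
  simp only [Ring.lie_def, map_sub, hD]
  abel

theorem exists_map_X_eq_smul_one {l : ℕ}
    (hDgen : ∀ j : Fin (2 * n), D (FreeAlgebra.ι ℂ j) = if (j : ℕ) = l - 1 then 1 else 0)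
    (j : ℕ) : ∃ c : ℂ, D (X n j) = c • 1 := by
  unfold X
  split_ifs with h
  · rw [hDgen]
    split_ifs
    · exact ⟨1, by simp⟩
    · exact ⟨0, by simp⟩
  · exact ⟨0, by simp⟩

theorem map_lie_X (hD : ∀ a b : FA n, D (a * b) = D a * b + a * D b)
    (hX : ∀ j, ∃ c : ℂ, D (X n j) = c • 1) (j : ℕ) (a : FA n) :
    D ⁅X n j, a⁆ = ⁅X n j, D a⁆ := by
  obtain ⟨c, hc⟩ := hX j
  rw [map_lie_of_leibniz hD, hc]
  simp [Ring.lie_def]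

theorem map_omg_pow (hD : ∀ a b : FA n, D (a * b) = D a * b + a * D b)
    (hX : ∀ j, ∃ c : ℂ, D (X n j) = c • 1) (s : ℕ) : D (omg n ^ s) = 0 := by
  have h1 : D 1 = 0 := by simpa using hD 1 1
  have hω : D (omg n) = 0 := by
    rw [omg, map_smul, map_sum, Finset.sum_eq_zero, smul_zero]
    intro i _
    obtain ⟨c, hc⟩ := hX (i + n)
    rw [← Ring.lie_def, map_lie_X hD hX, hc]
    simp [Ring.lie_def]
  induction s with
  | zero => simpa using h1
  | succ s ih => simp [pow_succ, hD, ih, hω]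

theorem map_lie_X_mul_mem_lcs_three (hD : ∀ a b : FA n, D (a * b) = D a * b + a * D b)
    (hX : ∀ j, ∃ c : ℂ, D (X n j) = c • 1) (i j : ℕ) {w : FA n}
    (hw : ⁅X n i, w⁆ ∈ lcs (FA n) 3) (hDw : D w ∈ lcs (FA n) 3) :
    D ⁅X n i, X n j * w⁆ ∈ lcs (FA n) 3 := by
  obtain ⟨c, hc⟩ := hX j
  have h : D ⁅X n i, X n j * w⁆ = c • ⁅X n i, w⁆ + ⁅X n i, X n j * D w⁆ := by
    rw [map_lie_X hD hX, hD, hc, lie_add, smul_mul_assoc, one_mul, lie_smul]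
  rw [h]
  exact add_mem (Submodule.smul_mem _ c hw) (lcs_succ_le 3 (lie_mul_mem_lcs_four _ _ hDw))

theorem map_uAux_mem_lcs_three (hD : ∀ a b : FA n, D (a * b) = D a * b + a * D b)
    (hX : ∀ j, ∃ c : ℂ, D (X n j) = c • 1) (s m i : ℕ) :
    D (uAux n s m i) ∈ lcs (FA n) 3 := by
  induction i with
  | zero =>
    refine map_lie_X_mul_mem_lcs_three hD hX m (m + 1) (lie_omg_pow_mem_lcs_three n s _) ?_
    rw [map_omg_pow hD hX]
    exact zero_mem _
  | succ i ih =>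
    exact map_lie_X_mul_mem_lcs_three hD hX _ _ (lie_mem_lcs 1 _ (uAux_mem_lcs_two n s m i)) ih

end Derivation

end LowerCentralSeries

/-- For `k` odd, `0 ≤ 2s ≤ k−1`, `1 ≤ k ≤ n`, with `m := k−2s`,
`u := [x_1, x_2·[x_3, x_4·[⋯[x_m, x_{m+1}·ω^s]⋯]]]` and `v := [x_1, u]`, for every
`1 ≤ l ≤ 2n` the element `∂_l(v)` lies in `L₄(A_{2n})`, where `∂_l` is the unique
ℂ-linear derivation of `A_{2n}` with `∂_l(x_j) = δ_{lj}`. -/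
theorem stmt6 (n : ℕ) (hn : 1 ≤ n) (k s : ℕ) (hodd : Odd k) (hs : 2*s ≤ k-1)
    (hk1 : 1 ≤ k) (hkn : k ≤ n)
    (m : ℕ) (hm : m = k - 2*s)
    (u : FA n) (hu : u = uAux n s m ((m-1)/2))
    (v : FA n) (hv : v = X n 1 * u - u * X n 1)
    (l : ℕ) (hl1 : 1 ≤ l) (hl2 : l ≤ 2*n)
    (D : FA n →ₗ[ℂ] FA n)
    (hD : ∀ a b : FA n, D (a * b) = D a * b + a * D b)
    (hDgen : ∀ j : Fin (2*n), D (FreeAlgebra.ι ℂ j) = if (j : ℕ) = l - 1 then 1 else 0) :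
    D v ∈ lcs (FA n) 4 := by
  have hX := exists_map_X_eq_smul_one hDgen
  rw [hv, hu, ← Ring.lie_def, map_lie_X hD hX]
  exact lie_mem_lcs 2 _ (map_uAux_mem_lcs_three hD hX s m _)
end
end
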